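/- arXiv:1610.00531 — 2 statements merged into one kernel-verified Lean document; each statement's English description precedes it below -/
import Mathlib

section
/- Let n ≥ 1, let q, λ, μ ∈ ℂ with q not a root of unity, λ ≠ 0, and let β ∈ ℤ_{≥0}^n with (μ;q)_{|β|} ≠ 0. Then Σ_{γ ∈ ℤ_{≥0}^n, γ ≤ β} Φ_q^{(n)}(γ|β;λ,μ) = 1. -/
/-- The q-Pochhammer symbol `(z;q)_m = ∏_{j=0}^{m-1} (1 - z q^j)`. -/
noncomputable def qPoch (q z : ℂ) (m : ℕ) : ℂ := ∏ j ∈ Finset.range m, (1 - z * q ^ j)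

/-- The q-binomial coefficient `binom(m,k)_q`. -/
noncomputable def qBinom (q : ℂ) (m k : ℕ) : ℂ :=
  if k ≤ m then qPoch q q m / (qPoch q q k * qPoch q q (m - k)) else 0

/-- `q` is not a root of unity. -/
def notRootOfUnity (q : ℂ) : Prop := ∀ m : ℕ, 0 < m → q ^ m ≠ 1

/-- `φ(β,γ) = Σ_{1 ≤ i < j ≤ k} β_i γ_j` for integer vectors. -/
def phi {k : ℕ} (β γ : Fin k → ℤ) : ℤ :=
  ∑ i, ∑ j, if i < j then β i * γ j else 0

open Classical in
/-- The weight `Φ_q^{(n)}(γ|β;λ,μ)` of the stochastic R matrix of `U_q(A^{(1)}_n)`. -/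
noncomputable def Phi (n : ℕ) (q lam mu : ℂ) (γ β : Fin n → ℕ) : ℂ :=
  if γ ≤ β then
    q ^ phi (fun i => (β i : ℤ) - (γ i : ℤ)) (fun i => (γ i : ℤ))
      * (mu / lam) ^ (∑ i, γ i)
      * qPoch q lam (∑ i, γ i) * qPoch q (mu / lam) ((∑ i, β i) - ∑ i, γ i)
      * (∏ i, qBinom q (β i) (γ i)) / qPoch q mu (∑ i, β i)
  else 0


theorem qPoch_succ (q z : ℂ) (m : ℕ) :
    qPoch q z (m + 1) = qPoch q z m * (1 - z * q ^ m) := by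
  simp [qPoch, Finset.prod_range_succ]

theorem qPoch_self_ne_zero {q : ℂ} (hq : notRootOfUnity q) (m : ℕ) : qPoch q q m ≠ 0 := by
  refine Finset.prod_ne_zero_iff.2 fun j _ h => hq (j + 1) j.succ_pos ?_
  rw [pow_succ']
  exact (sub_eq_zero.1 h).symm

theorem qBinom_zero_right {q : ℂ} (hq : notRootOfUnity q) (m : ℕ) : qBinom q m 0 = 1 := by
  have := qPoch_self_ne_zero hq m
  have h0 : qPoch q q 0 = 1 := by simp [qPoch]
  simp [qBinom, h0, this]

theorem qBinom_self {q : ℂ} (hq : notRootOfUnity q) (m : ℕ) : qBinom q m m = 1 := by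
  have := qPoch_self_ne_zero hq m
  have h0 : qPoch q q 0 = 1 := by simp [qPoch]
  simp [qBinom, h0, this]

theorem qBinom_eq_zero_of_lt (q : ℂ) {m k : ℕ} (h : m < k) : qBinom q m k = 0 := by
  simp [qBinom, h]

theorem qBinom_add (q : ℂ) (k d : ℕ) :
    qBinom q (k + d) k = qPoch q q (k + d) / (qPoch q q k * qPoch q q d) := by
  simp [qBinom]

/-- The two `q`-Pascal rules. -/
theorem qBinom_succ_succ {q : ℂ} (hq : notRootOfUnity q) {m k : ℕ} (hk : k ≤ m) :
    qBinom q (m + 1) (k + 1) = qBinom q m k + q ^ (k + 1) * qBinom q m (k + 1) ∧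
    qBinom q (m + 1) (k + 1) = q ^ (m - k) * qBinom q m k + qBinom q m (k + 1) := by
  obtain ⟨d, rfl⟩ := Nat.exists_eq_add_of_le hk
  cases d with
  | zero => simp [qBinom_self hq, qBinom_eq_zero_of_lt]
  | succ d =>
    have e1 := qBinom_add q (k + 1) (d + 1)
    have e2 := qBinom_add q (k + 1) d
    have e3 := qBinom_add q k (d + 1)
    have s1 := qPoch_succ q q (k + (d + 1))
    have s2 := qPoch_succ q q k
    have s3 := qPoch_succ q q d
    rw [show k + 1 + (d + 1) = k + (d + 1) + 1 by ring] at e1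
    rw [show k + 1 + d = k + (d + 1) by ring] at e2
    have n2 := qPoch_self_ne_zero hq (k + 1)
    have n3 := qPoch_self_ne_zero hq (d + 1)
    rw [e1, e2, e3, s1, Nat.add_sub_cancel_left]
    rw [s2] at n2 ⊢
    rw [s3] at n3 ⊢
    obtain ⟨hP, hp⟩ := mul_ne_zero_iff.1 n2
    obtain ⟨hD, hd⟩ := mul_ne_zero_iff.1 n3
    constructor <;> field_simp <;> ring

theorem sum_qBinom_succ {q : ℂ} (hq : notRootOfUnity q) (m : ℕ) (G : ℕ → ℂ) :
    ∑ k ∈ Finset.range (m + 2), qBinom q (m + 1) k * G k =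
      ∑ k ∈ Finset.range (m + 1), qBinom q m k * (G (k + 1) + q ^ k * G k) := by
  have h : ∑ k ∈ Finset.range (m + 1), qBinom q m k * (q ^ k * G k) =
      ∑ k ∈ Finset.range (m + 2), qBinom q m k * (q ^ k * G k) := by
    rw [Finset.sum_range_succ _ (m + 1), qBinom_eq_zero_of_lt q m.lt_succ_self]
    simp
  simp_rw [mul_add]
  rw [Finset.sum_add_distrib, h, Finset.sum_range_succ', Finset.sum_range_succ' _ (m + 1),
    ← add_assoc, ← Finset.sum_add_distrib, qBinom_zero_right hq, qBinom_zero_right hq]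
  congr 1
  · refine Finset.sum_congr rfl fun k hk => ?_
    rw [(qBinom_succ_succ hq (Nat.lt_succ_iff.1 (Finset.mem_range.1 hk))).1]
    ring
  · simp

theorem sum_qBinom_succ' {q : ℂ} (hq : notRootOfUnity q) (m : ℕ) (G : ℕ → ℂ) :
    ∑ k ∈ Finset.range (m + 2), qBinom q (m + 1) k * G k =
      ∑ k ∈ Finset.range (m + 1), qBinom q m k * (q ^ (m - k) * G (k + 1) + G k) := by
  have h : ∑ k ∈ Finset.range (m + 1), qBinom q m k * G k =
      ∑ k ∈ Finset.range (m + 2), qBinom q m k * G k := by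
    rw [Finset.sum_range_succ _ (m + 1), qBinom_eq_zero_of_lt q m.lt_succ_self]
    simp
  simp_rw [mul_add]
  rw [Finset.sum_add_distrib, h, Finset.sum_range_succ', Finset.sum_range_succ' _ (m + 1),
    ← add_assoc, ← Finset.sum_add_distrib, qBinom_zero_right hq, qBinom_zero_right hq]
  congr 1
  refine Finset.sum_congr rfl fun k hk => ?_
  rw [(qBinom_succ_succ hq (Nat.lt_succ_iff.1 (Finset.mem_range.1 hk))).2]
  ring

/-- The sum of the shift `F ↦ F (· + 1)` and the multiplication by `k ↦ q ^ k`, two operators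
that commute up to a factor `q`. -/
def qShift (q : ℂ) (F : ℕ → ℂ) (k : ℕ) : ℂ := F (k + 1) + q ^ k * F k

/-- Noncommutative `q`-binomial theorem for the powers of `qShift`. -/
theorem qShift_iterate {q : ℂ} (hq : notRootOfUnity q) (m : ℕ) (F : ℕ → ℂ) (j : ℕ) :
    (qShift q)^[m] F j =
      ∑ k ∈ Finset.range (m + 1), qBinom q m k * (q ^ ((m - k) * j) * F (k + j)) := by
  induction m generalizing F with
  | zero => simp [qBinom_zero_right hq]
  | succ m ih =>
    rw [Function.iterate_succ_apply, ih,
      sum_qBinom_succ hq m fun k => q ^ ((m + 1 - k) * j) * F (k + j)]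
    refine Finset.sum_congr rfl fun k hk => ?_
    obtain ⟨d, rfl⟩ := Nat.exists_eq_add_of_le (Nat.lt_succ_iff.1 (Finset.mem_range.1 hk))
    rw [show k + d + 1 - (k + 1) = d by omega, show k + d + 1 - k = d + 1 by omega,
      show k + d - k = d by omega, show k + 1 + j = k + j + 1 by omega, qShift]
    ring

/-- The exponent `φ(β - γ, γ)` as a natural number, for `γ ≤ β`. -/
def natPhi {n : ℕ} (β γ : Fin n → ℕ) : ℕ :=
  ∑ i, ∑ j, if i < j then (β i - γ i) * γ j else 0

theorem phi_sub_eq_natPhi {n : ℕ} {β γ : Fin n → ℕ} (h : γ ≤ β) :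
    phi (fun i => (β i : ℤ) - (γ i : ℤ)) (fun i => (γ i : ℤ)) = natPhi β γ := by
  simp only [phi, natPhi, Nat.cast_sum]
  refine Finset.sum_congr rfl fun i _ => Finset.sum_congr rfl fun j _ => ?_
  split_ifs <;> simp [Nat.cast_sub (h i)]

theorem natPhi_succ {n : ℕ} (β γ : Fin (n + 1) → ℕ) :
    natPhi β γ = (β 0 - γ 0) * ∑ i, Fin.tail γ i + natPhi (Fin.tail β) (Fin.tail γ) := by
  simp [natPhi, Fin.sum_univ_succ, Finset.mul_sum, Fin.tail]

theorem sum_Iic_fin_succ {n : ℕ} (β : Fin (n + 1) → ℕ) (f : (Fin (n + 1) → ℕ) → ℂ) :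
    ∑ γ ∈ Finset.Iic β, f γ =
      ∑ γ ∈ Finset.Iic (Fin.tail β), ∑ a ∈ Finset.range (β 0 + 1), f (Fin.cons a γ) := by
  rw [Finset.sum_sigma']
  refine Finset.sum_bij' (fun γ _ => ⟨Fin.tail γ, γ 0⟩) (fun p _ => Fin.cons p.2 p.1)
    ?_ ?_ ?_ ?_ ?_
  · intro γ hγ
    have hγ := Finset.mem_Iic.1 hγ
    simp only [Finset.mem_sigma, Finset.mem_Iic, Finset.mem_range]
    exact ⟨fun i => hγ i.succ, Nat.lt_succ_iff.2 (hγ 0)⟩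
  · intro p hp
    simp only [Finset.mem_sigma, Finset.mem_Iic, Finset.mem_range] at hp
    refine Finset.mem_Iic.2 fun i => ?_
    refine Fin.cases ?_ (fun i => ?_) i
    · simpa using Nat.lt_succ_iff.1 hp.2
    · exact hp.1 i
  · simp
  · simp
  · simp

theorem sum_Iic_qBinom {q : ℂ} (hq : notRootOfUnity q) {n : ℕ} (β : Fin n → ℕ) (F : ℕ → ℂ) :
    ∑ γ ∈ Finset.Iic β, q ^ natPhi β γ * (∏ i, qBinom q (β i) (γ i)) * F (∑ i, γ i) =
      (qShift q)^[∑ i, β i] F 0 := by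
  induction n generalizing F with
  | zero =>
    have : Finset.Iic β = {β} := by
      ext γ
      simp [Subsingleton.elim γ β]
    simp [this, natPhi]
  | succ n ih =>
    have e : ∑ i, β i = ∑ i, Fin.tail β i + β 0 := by
      rw [Fin.sum_univ_succ, add_comm]
      rfl
    rw [e, Function.iterate_add_apply, ← ih, sum_Iic_fin_succ]
    refine Finset.sum_congr rfl fun γ _ => ?_
    rw [qShift_iterate hq, Finset.mul_sum]
    refine Finset.sum_congr rfl fun a _ => ?_
    rw [natPhi_succ, Fin.prod_univ_succ, Fin.sum_univ_succ]
    simp only [Fin.cons_zero, Fin.cons_succ, Fin.tail_cons, Fin.tail, pow_add]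
    ring

/-- The `q`-Chu–Vandermonde identity. -/
theorem sum_qBinom_mul_qPoch {q : ℂ} (hq : notRootOfUnity q) (lam x : ℂ) (N : ℕ) :
    ∑ k ∈ Finset.range (N + 1),
      qBinom q N k * (x ^ k * qPoch q lam k * qPoch q x (N - k)) = qPoch q (lam * x) N := by
  induction N with
  | zero => simp [qBinom_zero_right hq, qPoch]
  | succ N ih =>
    rw [sum_qBinom_succ' hq N fun k => x ^ k * qPoch q lam k * qPoch q x (N + 1 - k),
      qPoch_succ, ← ih, Finset.sum_mul]
    refine Finset.sum_congr rfl fun k hk => ?_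
    obtain ⟨d, rfl⟩ := Nat.exists_eq_add_of_le (Nat.lt_succ_iff.1 (Finset.mem_range.1 hk))
    rw [show k + d + 1 - (k + 1) = d by omega, show k + d + 1 - k = d + 1 by omega,
      show k + d - k = d by omega, qPoch_succ, qPoch_succ]
    ring

/-- Sum-to-unity: `Σ_{γ ≤ β} Φ_q^{(n)}(γ|β;λ,μ) = 1`. -/
theorem sum_to_unity (n : ℕ) (hn : 1 ≤ n) (q lam mu : ℂ) (hq : notRootOfUnity q)
    (hlam : lam ≠ 0) (β : Fin n → ℕ) (h : qPoch q mu (∑ i, β i) ≠ 0) :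
    ∑ γ ∈ Finset.Iic β, Phi n q lam mu γ β = 1 := by
  have key := sum_Iic_qBinom hq β fun k =>
    (mu / lam) ^ k * qPoch q lam k * qPoch q (mu / lam) ((∑ i, β i) - k)
  rw [qShift_iterate hq] at key
  simp only [mul_zero, pow_zero, one_mul, add_zero] at key
  rw [sum_qBinom_mul_qPoch hq, mul_div_cancel₀ _ hlam] at key
  rw [← div_self h]
  nth_rw 1 [← key]
  rw [Finset.sum_div]
  refine Finset.sum_congr rfl fun γ hγ => ?_
  have hγ := Finset.mem_Iic.1 hγ
  rw [Phi, if_pos hγ, phi_sub_eq_natPhi hγ, zpow_natCast]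
  ring
end

section
/- Let n ≥ 2, let q, λ, μ ∈ ℂ with q nonzero and not a root of unity, λ ≠ 0, and let γ, α ∈ ℤ_{≥0}^n with γ ≤ α and (μ;q)_{|α|} ≠ 0. Write γ̲ = (γ_1,…,γ_{n−1}), α̲ = (α_1,…,α_{n−1}). Then Φ_q^{(n)}(γ|α;λ,μ) = Φ_q^{(n−1)}(γ̲|α̲;λ,μ) · Φ_q^{(1)}(γ_n|α_n; q^{|γ̲|}λ, q^{|α̲|}μ), provided (μ;q)_{|α̲|} ≠ 0 and (q^{|α̲|}μ;q)_{α_n} ≠ 0. -/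
theorem qPoch_add (q z : ℂ) (m k : ℕ) :
    qPoch q z (m + k) = qPoch q z m * qPoch q (q ^ m * z) k := by
  unfold qPoch
  rw [Finset.prod_range_add]
  congr 1
  refine Finset.prod_congr rfl fun j _ => ?_
  ring

theorem phi_succ {N : ℕ} (β γ : Fin (N + 1) → ℤ) :
    phi β γ = phi (Fin.init β) (Fin.init γ) + (∑ i, Fin.init β i) * γ (Fin.last N) := by
  have h (i : Fin N) : ¬ Fin.last N < i.castSucc := (Fin.castSucc_lt_last i).not_gt
  simp [phi, Fin.sum_univ_castSucc, Fin.init, Finset.sum_add_distrib, Finset.sum_mul, h]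

theorem phi_one (β γ : Fin 1 → ℤ) : phi β γ = 0 := by
  simp [phi]

theorem sum_univ_eq_sum_init_add_last {N : ℕ} (f : Fin (N + 1) → ℕ) :
    ∑ i, f i = ∑ i, Fin.init f i + f (Fin.last N) :=
  Fin.sum_univ_castSucc f

/-- Last-coordinate factorization of `Φ`:
`Φ_q^{(n)}(γ|α;λ,μ) = Φ_q^{(n−1)}(γ̲|α̲;λ,μ) Φ_q^{(1)}(γ_n|α_n;q^{|γ̲|}λ,q^{|α̲|}μ)`
(stated with `n = N+1`, `N ≥ 1`, so that `n ≥ 2`). -/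
theorem Phi_factor_last (N : ℕ) (hN : 1 ≤ N) (q lam mu : ℂ) (hq0 : q ≠ 0)
    (hq : notRootOfUnity q) (hlam : lam ≠ 0)
    (γ α : Fin (N + 1) → ℕ) (hge : γ ≤ α)
    (hmu : qPoch q mu (∑ i, α i) ≠ 0)
    (h1 : qPoch q mu (∑ i, Fin.init α i) ≠ 0)
    (h2 : qPoch q (q ^ (∑ i, Fin.init α i) * mu) (α (Fin.last N)) ≠ 0) :
    Phi (N + 1) q lam mu γ α =
      Phi N q lam mu (Fin.init γ) (Fin.init α) *
        Phi 1 q (q ^ (∑ i, Fin.init γ i) * lam) (q ^ (∑ i, Fin.init α i) * mu)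
          (fun _ => γ (Fin.last N)) (fun _ => α (Fin.last N)) := by
  have hinit : Fin.init γ ≤ Fin.init α := fun i => hge i.castSucc
  have hlast : γ (Fin.last N) ≤ α (Fin.last N) := hge _
  have hsum : ∑ i, Fin.init γ i ≤ ∑ i, Fin.init α i := Finset.sum_le_sum fun i _ => hinit i
  have hconst : (fun _ : Fin 1 => γ (Fin.last N)) ≤ fun _ => α (Fin.last N) := fun _ => hlast
  have hphi : phi (fun i => (α i : ℤ) - (γ i : ℤ)) (fun i => (γ i : ℤ)) =
      phi (fun i => (Fin.init α i : ℤ) - (Fin.init γ i : ℤ)) (fun i => (Fin.init γ i : ℤ)) +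
        (((∑ i, Fin.init α i - ∑ i, Fin.init γ i) * γ (Fin.last N) : ℕ) : ℤ) := by
    rw [phi_succ, Nat.cast_mul, Nat.cast_sub hsum, Nat.cast_sum, Nat.cast_sum,
      ← Finset.sum_sub_distrib]
    rfl
  have hprod : ∏ i, qBinom q (α i) (γ i) =
      (∏ i, qBinom q (Fin.init α i) (Fin.init γ i)) *
        qBinom q (α (Fin.last N)) (γ (Fin.last N)) :=
    Fin.prod_univ_castSucc _
  unfold Phi
  rw [if_pos hge, if_pos hinit, if_pos hconst, hphi, hprod, phi_one,
    sum_univ_eq_sum_init_add_last α, sum_univ_eq_sum_init_add_last γ]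
  simp only [Finset.univ_unique, Finset.sum_singleton, Finset.prod_singleton]
  generalize ∑ i, Fin.init α i = A at *
  generalize ∑ i, Fin.init γ i = G at *
  have hratio : q ^ A * mu / (q ^ G * lam) = q ^ (A - G) * (mu / lam) := by
    rw [pow_sub₀ q hq0 hsum]
    field_simp
  rw [hratio, show A + α (Fin.last N) - (G + γ (Fin.last N)) =
      (A - G) + (α (Fin.last N) - γ (Fin.last N)) by omega,
    qPoch_add, qPoch_add, qPoch_add, zpow_add₀ hq0, zpow_natCast, pow_mul, mul_pow, pow_add,
    zpow_zero]
  ring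
end
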